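/- arXiv:2002.12361 — 4 statements merged into one kernel-verified Lean document; each statement's English description precedes it below -/
import Mathlib

section
/- Let V_0, V_1, V_2, … be defined by the SGTDP recursion: V_0(s,s') = c(s,s') for all s ≠ s'; V_k(s,s) = 0 for all s and all k; and V_k(s,s') = min over s_m ∈ S of ( V_{k-1}(s, s_m) + V_{k-1}(s_m, s') ) for all s ≠ s' and k ≥ 1. Let V*(s,s') denote the infimum of the costs of paths from s to s' of any length. If the number of vertices is N, then for every k with 2^k ≥ N and all s, s' ∈ S, V_k(s,s') = V*(s,s'). -/
open scoped ENNReal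

noncomputable section

/-- The cost of a path given as a list of visited vertices:
the sum of edge costs of consecutive vertices. A path with 0 edges has cost 0. -/
def pathCost {S : Type*} (c : S → S → ℝ≥0∞) : List S → ℝ≥0∞
  | [] => 0
  | [_] => 0
  | a :: b :: rest => c a b + pathCost c (b :: rest)

/-- The infimum of the costs of paths from `s` to `g` of any length. -/
def minCost {S : Type*} (c : S → S → ℝ≥0∞) (s g : S) : ℝ≥0∞ :=
  sInf {x | ∃ p : List S, p.head? = some s ∧ p.getLast? = some g ∧ pathCost c p = x}

theorem pathCost_append_cons {S : Type*} (c : S → S → ℝ≥0∞) (a : S) (l₂ : List S) :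
    ∀ l₁ : List S,
      pathCost c (l₁ ++ a :: l₂) = pathCost c (l₁ ++ [a]) + pathCost c (a :: l₂)
  | [] => by simp [pathCost]
  | [b] => by simp [pathCost]
  | b :: d :: l => by
    have ih := pathCost_append_cons c a l₂ (d :: l)
    simp only [List.cons_append, pathCost] at ih ⊢
    rw [ih, add_assoc]

theorem minCost_le_pathCost {S : Type*} (c : S → S → ℝ≥0∞) {s g : S} {p : List S}
    (hs : p.head? = some s) (hg : p.getLast? = some g) : minCost c s g ≤ pathCost c p :=
  sInf_le ⟨p, hs, hg, rfl⟩

theorem minCost_self {S : Type*} (c : S → S → ℝ≥0∞) (s : S) : minCost c s s = 0 :=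
  le_antisymm (minCost_le_pathCost c (p := [s]) rfl rfl) zero_le

theorem minCost_le_edge {S : Type*} (c : S → S → ℝ≥0∞) (s g : S) :
    minCost c s g ≤ c s g :=
  (minCost_le_pathCost c (p := [s, g]) rfl rfl).trans_eq (by simp [pathCost])

theorem minCost_triangle {S : Type*} (c : S → S → ℝ≥0∞) (s m g : S) :
    minCost c s g ≤ minCost c s m + minCost c m g := by
  conv_rhs => rw [minCost, minCost, ENNReal.sInf_add]
  refine le_iInf₂ ?_
  rintro _ ⟨p, hps, hpm, rfl⟩
  rw [ENNReal.add_sInf]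
  refine le_iInf₂ ?_
  rintro _ ⟨q, hqm, hqg, rfl⟩
  obtain ⟨l₁, rfl⟩ := List.getLast?_eq_some_iff.mp hpm
  obtain ⟨l₂, rfl⟩ := List.head?_eq_some_iff.mp hqm
  rw [← pathCost_append_cons]
  refine minCost_le_pathCost c ?_ ?_
  · cases l₁ <;> simpa using hps
  · rw [List.getLast?_append, hqg]; rfl

/-- Every path can be shortened to one without repeated vertices, at no greater cost. -/
theorem exists_nodup_pathCost_le {S : Type*} (c : S → S → ℝ≥0∞) {s g : S} {p : List S}
    (hs : p.head? = some s) (hg : p.getLast? = some g) :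
    ∃ q : List S, q.head? = some s ∧ q.getLast? = some g ∧ q.Nodup ∧
      pathCost c q ≤ pathCost c p := by
  induction p generalizing s with
  | nil => simp at hs
  | cons a p ih =>
    obtain rfl : a = s := by simpa using hs
    cases p with
    | nil => exact ⟨[a], rfl, hg, by simp, le_rfl⟩
    | cons b p =>
      obtain ⟨q, hqb, hqg, hq, hle⟩ := ih rfl (by simpa using hg)
      by_cases ha : a ∈ q
      · obtain ⟨l₁, l₂, rfl⟩ := List.append_of_mem ha
        refine ⟨a :: l₂, rfl, ?_, hq.of_append_right, ?_⟩
        · rw [List.getLast?_append] at hqg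
          simpa [List.getLast?_cons] using hqg
        · rw [pathCost_append_cons] at hle
          exact (le_add_self.trans hle).trans le_add_self
      · obtain ⟨l, rfl⟩ := List.head?_eq_some_iff.mp hqb
        refine ⟨a :: b :: l, rfl, by simpa using hqg, List.nodup_cons.mpr ⟨ha, hq⟩, ?_⟩
        exact add_le_add le_rfl hle

/-- Path doubling: after `k` rounds of midpoint minimization, `V k` is at most the cost of every
path with at most `2 ^ k` edges. -/
theorem doubling_le_pathCost {S : Type*} (c : S → S → ℝ≥0∞) (V : ℕ → S → S → ℝ≥0∞)
    (hV0 : ∀ s g : S, V 0 s g ≤ c s g) (hVdiag : ∀ (k : ℕ) (s : S), V k s s = 0)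
    (hVrec : ∀ (k : ℕ) (s m g : S), V (k + 1) s g ≤ V k s m + V k m g)
    (k : ℕ) {s g : S} {p : List S} (hs : p.head? = some s) (hg : p.getLast? = some g)
    (hp : p.length ≤ 2 ^ k + 1) : V k s g ≤ pathCost c p := by
  induction k generalizing s g p with
  | zero =>
    match p, hs, hg, hp with
    | [a], hs, hg, _ =>
      obtain rfl : a = s := by simpa using hs
      obtain rfl : a = g := by simpa using hg
      simp [hVdiag]
    | [a, b], hs, hg, _ =>
      obtain rfl : a = s := by simpa using hs
      obtain rfl : b = g := by simpa using hg
      simpa [pathCost] using hV0 a b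
    | _ :: _ :: _ :: _, _, _, hp => simp at hp
  | succ k ih =>
    by_cases hk : p.length ≤ 2 ^ k + 1
    · calc V (k + 1) s g ≤ V k s g + V k g g := hVrec k s g g
        _ = V k s g := by rw [hVdiag, add_zero]
        _ ≤ pathCost c p := ih hs hg hk
    · obtain ⟨l₁, m, l₂, rfl, hl⟩ :
          ∃ l₁ m l₂, p = l₁ ++ m :: l₂ ∧ l₁.length = 2 ^ k := by
        have hlt : 2 ^ k < p.length := by omega
        exact ⟨p.take (2 ^ k), p[2 ^ k], p.drop (2 ^ k + 1), by simp,
          by simp [hlt.le]⟩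
      rw [pathCost_append_cons]
      refine (hVrec k s m g).trans (add_le_add (ih ?_ ?_ ?_) (ih rfl ?_ ?_))
      · cases l₁ <;> simpa using hs
      · simp
      · simp [hl]
      · simpa [List.getLast?_append, List.getLast?_cons] using hg
      · simp only [List.length_append, List.length_cons, pow_succ] at hp ⊢
        omega

/-- With `V_k` defined by the SGTDP recursion, and `V*` the infimum of the
costs of paths of any length, if the number of vertices is `N` then for every `k` with
`2^k ≥ N` and all `s, s'`, `V_k(s,s') = V*(s,s')`. -/
theorem sgtdp_value_eq_shortest_path {S : Type*} [Fintype S] [Nonempty S]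
    (c : S → S → ℝ≥0∞) (hdiag : ∀ s : S, c s s = 0)
    (V : ℕ → S → S → ℝ≥0∞)
    (hV0 : ∀ s s' : S, s ≠ s' → V 0 s s' = c s s')
    (hVdiag : ∀ (k : ℕ) (s : S), V k s s = 0)
    (hVrec : ∀ (k : ℕ) (s s' : S), s ≠ s' →
      V (k + 1) s s' = ⨅ m : S, (V k s m + V k m s'))
    (N : ℕ) (hN : Fintype.card S = N) :
    ∀ k : ℕ, N ≤ 2 ^ k → ∀ s s' : S, V k s s' = minCost c s s' := by
  have hzero (s g : S) : V 0 s g = c s g := by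
    by_cases h : s = g
    · subst h
      rw [hVdiag, hdiag]
    · exact hV0 s g h
  have hstep (k : ℕ) (s m g : S) : V (k + 1) s g ≤ V k s m + V k m g := by
    by_cases h : s = g
    · subst h
      simp [hVdiag]
    · rw [hVrec k s g h]
      exact iInf_le _ m
  have hlower (k : ℕ) : ∀ s g : S, minCost c s g ≤ V k s g := by
    induction k with
    | zero => exact fun s g => (minCost_le_edge c s g).trans_eq (hzero s g).symm
    | succ k ih =>
      intro s g
      by_cases h : s = g
      · subst h
        simp [minCost_self]
      · rw [hVrec k s g h]
        exact le_iInf fun m =>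
          (minCost_triangle c s m g).trans (add_le_add (ih s m) (ih m g))
  intro k hk s g
  refine le_antisymm (le_sInf ?_) (hlower k s g)
  rintro _ ⟨p, hs, hg, rfl⟩
  obtain ⟨q, hqs, hqg, hq, hle⟩ := exists_nodup_pathCost_le c hs hg
  have hlen : q.length ≤ 2 ^ k + 1 := by
    have := hq.length_le_card
    omega
  exact (doubling_le_pathCost c V (fun s g => (hzero s g).le) hVdiag hstep k hqs hqg hlen).trans hle
end
end

section
/- Let V̂_0, …, V̂_K be an ε-approximate SGTDP sequence, let 1 ≤ k ≤ K, let s, g ∈ S, and let ŝ_m be any minimizer over s_m ∈ S of V̂_{k−1}(s, s_m) + V̂_{k−1}(s_m, g). Then | V_{k−1}(s, ŝ_m) + V_{k−1}(ŝ_m, g) − V_k(s, g) | ≤ 2^{k+2}·ε, where V_j(s,s') denotes the minimum cost of a path from s to s' using at most 2^j edges. -/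
noncomputable section

/-- The SGTDP operator: `(TV)(s,s') = min over s_m of (V(s, s_m) + V(s_m, s'))`. -/
def sgtOp {S : Type*} [Fintype S] [Nonempty S] (V : S → S → ℝ) : S → S → ℝ :=
  fun s g => Finset.univ.inf' Finset.univ_nonempty fun m => V s m + V m g

theorem sgtOp_le {S : Type*} [Fintype S] [Nonempty S] (V : S → S → ℝ) (s g m : S) :
    sgtOp V s g ≤ V s m + V m g :=
  Finset.inf'_le _ (Finset.mem_univ m)

theorem exists_sgtOp_eq {S : Type*} [Fintype S] [Nonempty S] (V : S → S → ℝ) (s g : S) :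
    ∃ m, sgtOp V s g = V s m + V m g := by
  obtain ⟨m, -, hm⟩ := Finset.exists_mem_eq_inf' Finset.univ_nonempty fun m => V s m + V m g
  exact ⟨m, hm⟩

/-- The operator `sgtOp` is `2`-Lipschitz for the sup norm. -/
theorem abs_sgtOp_sub_sgtOp_le {S : Type*} [Fintype S] [Nonempty S] {V W : S → S → ℝ} {δ : ℝ}
    (h : ∀ s g, |V s g - W s g| ≤ δ) (s g : S) :
    |sgtOp V s g - sgtOp W s g| ≤ 2 * δ := by
  obtain ⟨m, hm⟩ := exists_sgtOp_eq V s g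
  obtain ⟨n, hn⟩ := exists_sgtOp_eq W s g
  have hV := sgtOp_le V s g n
  have hW := sgtOp_le W s g m
  have h₁ := abs_le.mp (h s m)
  have h₂ := abs_le.mp (h m g)
  have h₃ := abs_le.mp (h s n)
  have h₄ := abs_le.mp (h n g)
  rw [abs_le]
  constructor <;> linarith

theorem abs_approx_sub_iterate_sgtOp_le {S : Type*} [Fintype S] [Nonempty S]
    {c : S → S → ℝ} {ε : ℝ} {K : ℕ} {Vhat : ℕ → S → S → ℝ}
    (h0 : ∀ s s' : S, |Vhat 0 s s' - c s s'| ≤ ε)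
    (hstep : ∀ k : ℕ, k < K → ∀ s s' : S, |Vhat (k + 1) s s' - sgtOp (Vhat k) s s'| ≤ ε)
    {j : ℕ} (hj : j ≤ K) (s g : S) :
    |Vhat j s g - (sgtOp^[j] c) s g| ≤ (2 ^ (j + 1) - 1) * ε := by
  induction j generalizing s g with
  | zero => simpa [show (2 : ℝ) - 1 = 1 by norm_num] using h0 s g
  | succ j ih =>
    rw [Function.iterate_succ_apply']
    calc
      _ ≤ |Vhat (j + 1) s g - sgtOp (Vhat j) s g| +
          |sgtOp (Vhat j) s g - sgtOp (sgtOp^[j] c) s g| := abs_sub_le _ _ _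
      _ ≤ ε + 2 * ((2 ^ (j + 1) - 1) * ε) :=
        add_le_add (hstep j hj s g) (abs_sgtOp_sub_sgtOp_le (ih (Nat.le_of_succ_le hj)) s g)
      _ = (2 ^ (j + 1 + 1) - 1) * ε := by ring

/-- For an `ε`-approximate SGTDP sequence `V̂_0, …, V̂_K`, `1 ≤ k ≤ K`,
`s, g ∈ S`, and `ŝ_m` a minimizer of `V̂_{k−1}(s, s_m) + V̂_{k−1}(s_m, g)`, we have
`|V_{k−1}(s, ŝ_m) + V_{k−1}(ŝ_m, g) − V_k(s, g)| ≤ 2^{k+2}·ε`,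
where `V_j = T^j V_0` (the minimum cost of a path using at most `2^j` edges). -/
theorem approx_sgtdp_midpoint_error {S : Type*} [Fintype S] [Nonempty S]
    (c : S → S → ℝ) (hcnn : ∀ s s' : S, 0 ≤ c s s') (hdiag : ∀ s : S, c s s = 0)
    (ε : ℝ) (hε : 0 ≤ ε) (K : ℕ) (Vhat : ℕ → S → S → ℝ)
    (h0 : ∀ s s' : S, |Vhat 0 s s' - c s s'| ≤ ε)
    (hstep : ∀ k : ℕ, k < K → ∀ s s' : S,
      |Vhat (k + 1) s s' - sgtOp (Vhat k) s s'| ≤ ε)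
    (k : ℕ) (hk1 : 1 ≤ k) (hkK : k ≤ K) (s g sm : S)
    (hmin : ∀ m : S, Vhat (k - 1) s sm + Vhat (k - 1) sm g ≤
      Vhat (k - 1) s m + Vhat (k - 1) m g) :
    |(sgtOp^[k - 1] c) s sm + (sgtOp^[k - 1] c) sm g - (sgtOp^[k] c) s g| ≤
      2 ^ (k + 2) * ε := by
  obtain ⟨j, rfl⟩ : ∃ j, k = j + 1 := ⟨k - 1, by omega⟩
  rw [Nat.add_sub_cancel] at hmin ⊢
  rw [Function.iterate_succ_apply']
  have herr (x y : S) := abs_le.mp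
    (abs_approx_sub_iterate_sgtOp_le h0 hstep (Nat.le_of_succ_le hkK) x y)
  obtain ⟨m, hm⟩ := exists_sgtOp_eq (sgtOp^[j] c) s g
  have hle := sgtOp_le (sgtOp^[j] c) s g sm
  have h₁ := herr s sm
  have h₂ := herr sm g
  have h₃ := herr s m
  have h₄ := herr m g
  have hpow : (2 : ℝ) ^ (j + 1 + 2) * ε = 4 * ((2 ^ (j + 1) - 1) * ε) + 4 * ε := by ring
  rw [abs_of_nonneg (sub_nonneg.mpr hle)]
  linarith [hmin m]
end
end

section
/- Let the graph have N = 2^K vertices with K ≥ 1, let V̂_0, …, V̂_K be an ε-approximate SGTDP sequence, fix s, g ∈ S, and let s_0, s_1, …, s_N be an approximate greedy SGT trajectory from s to g constructed with respect to V̂_0, …, V̂_K. Then Σ_{i=0}^{N−1} c(s_i, s_{i+1}) ≤ V*(s, g) + 4·N·log₂(N)·ε, where V*(s,g) is the minimum cost of a path from s to g. -/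
noncomputable section

/-- The cost of a path given as a list of visited vertices:
the sum of edge costs of consecutive vertices. A path with 0 edges has cost 0. -/
def pathCostR {S : Type*} (c : S → S → ℝ) : List S → ℝ
  | [] => 0
  | [_] => 0
  | a :: b :: rest => c a b + pathCostR c (b :: rest)

/-- `V*(s,g)`: the minimum (infimum) cost over all paths from `s` to `g`. -/
def VstarR {S : Type*} (c : S → S → ℝ) (s g : S) : ℝ :=
  sInf {x | ∃ p : List S, p.head? = some s ∧ p.getLast? = some g ∧ pathCostR c p = x}

theorem pathCostR_nonneg {S : Type*} {c : S → S → ℝ} (hc : ∀ s s', 0 ≤ c s s') :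
    ∀ p : List S, 0 ≤ pathCostR c p
  | [] => le_rfl
  | [_] => le_rfl
  | a :: b :: rest => add_nonneg (hc a b) (pathCostR_nonneg hc (b :: rest))

theorem pathCostR_le_cons {S : Type*} {c : S → S → ℝ} (hc : ∀ s s', 0 ≤ c s s') (a : S) :
    ∀ p : List S, pathCostR c p ≤ pathCostR c (a :: p)
  | [] => le_rfl
  | b :: _ => le_add_of_nonneg_left (hc a b)

theorem pathCostR_le_append {S : Type*} {c : S → S → ℝ} (hc : ∀ s s', 0 ≤ c s s')
    (l p : List S) : pathCostR c p ≤ pathCostR c (l ++ p) := by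
  induction l with
  | nil => exact le_rfl
  | cons a l ih => exact ih.trans (pathCostR_le_cons hc a (l ++ p))

/-- Loop erasure: every path can be replaced by a simple one with the same endpoints
and no greater cost. -/
theorem exists_nodup_pathCostR_le {S : Type*} {c : S → S → ℝ} (hc : ∀ s s', 0 ≤ c s s')
    (p : List S) : ∃ q : List S, q.Nodup ∧ q.head? = p.head? ∧ q.getLast? = p.getLast? ∧
      pathCostR c q ≤ pathCostR c p := by
  induction p with
  | nil => exact ⟨[], List.nodup_nil, rfl, rfl, le_rfl⟩
  | cons a p ih =>
    obtain ⟨q, hq, hhead, hlast, hcost⟩ := ih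
    by_cases ha : a ∈ q
    · obtain ⟨l₁, l₂, rfl⟩ := List.append_of_mem ha
      refine ⟨a :: l₂, hq.of_append_right, rfl, ?_, ?_⟩
      · rw [List.getLast?_append_cons] at hlast
        rw [hlast]
        cases p with
        | nil => simp at hhead
        | cons b p => rw [List.getLast?_cons_cons]
      · exact (pathCostR_le_append hc l₁ _).trans (hcost.trans (pathCostR_le_cons hc a p))
    · refine ⟨a :: q, List.nodup_cons.mpr ⟨ha, hq⟩, rfl, ?_, ?_⟩
      · rw [List.getLast?_cons, List.getLast?_cons, hlast]
      · cases p with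
        | nil =>
          have : q = [] := by simpa using hhead
          rw [this]
        | cons b p =>
          cases q with
          | nil => simp at hhead
          | cons b' q =>
            have hb : b' = b := by simpa using hhead
            subst hb
            exact add_le_add le_rfl hcost

/-- The cost of a path is unchanged when it is padded with copies of its last vertex. -/
theorem sum_getD_eq_pathCostR {S : Type*} {c : S → S → ℝ} (hdiag : ∀ s, c s s = 0) (g : S) :
    ∀ (p : List S) (n : ℕ), p.getLast? = some g → p.length ≤ n + 1 →
      ∑ t ∈ Finset.range n, c (p.getD t g) (p.getD (t + 1) g) = pathCostR c p
  | [], _, h, _ => by simp at h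
  | [a], n, h, _ => by
    have ha : a = g := by simpa using h
    subst ha
    refine Finset.sum_eq_zero fun t _ => ?_
    cases t <;> simp [hdiag]
  | a :: b :: rest, 0, _, hn => by simp at hn
  | a :: b :: rest, n + 1, h, hn => by
    rw [Finset.sum_range_succ', pathCostR,
      ← sum_getD_eq_pathCostR hdiag g (b :: rest) n (by rwa [List.getLast?_cons_cons] at h)
        (by simpa using hn), add_comm]
    simp only [List.getD_cons_succ, List.getD_cons_zero]

/-- The approximate value at level `k` is bounded by the cost of any walk with `2 ^ k` edges,
up to the accumulated error. -/
theorem approx_sgt_le_sum {S : Type*} [Fintype S] [Nonempty S] {K : ℕ} {c : S → S → ℝ} {ε : ℝ}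
    {Vhat : ℕ → S → S → ℝ} (h0 : ∀ s s' : S, |Vhat 0 s s' - c s s'| ≤ ε)
    (hstep : ∀ k : ℕ, k < K → ∀ s s' : S, |Vhat (k + 1) s s' - sgtOp (Vhat k) s s'| ≤ ε)
    (k : ℕ) (hk : k ≤ K) (f : ℕ → S) :
    Vhat k (f 0) (f (2 ^ k)) ≤
      ∑ t ∈ Finset.range (2 ^ k), c (f t) (f (t + 1)) + (2 ^ (k + 1) - 1) * ε := by
  induction k generalizing f with
  | zero =>
    have := (abs_le.mp (h0 (f 0) (f 1))).2
    norm_num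
    linarith
  | succ k ih =>
    have hV := (abs_le.mp (hstep k hk (f 0) (f (2 ^ (k + 1))))).2
    have hT : sgtOp (Vhat k) (f 0) (f (2 ^ (k + 1))) ≤
        Vhat k (f 0) (f (2 ^ k)) + Vhat k (f (2 ^ k)) (f (2 ^ (k + 1))) :=
      Finset.inf'_le _ (Finset.mem_univ (f (2 ^ k)))
    have hl := ih (by omega) f
    have hr := ih (by omega) fun t => f (2 ^ k + t)
    have hpow : 2 ^ (k + 1) = 2 ^ k + 2 ^ k := by ring
    rw [hpow] at hV hT ⊢
    rw [Finset.sum_range_add]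
    simp only [add_zero, ← add_assoc] at hr ⊢
    have hε : ((2 : ℝ) ^ (k + 1 + 1) - 1) * ε =
        (2 ^ (k + 1) - 1) * ε + (2 ^ (k + 1) - 1) * ε + ε := by ring
    linarith

/-- Refining one level of the greedy trajectory costs at most `ε` per segment, so the values
at the finest level over a block of `2 ^ k` edges exceed the value at level `k` by at most
`(2 ^ k - 1) * ε`. -/
theorem sum_approx_sgt_le {S : Type*} [Fintype S] [Nonempty S] {K : ℕ} {ε : ℝ}
    {Vhat : ℕ → S → S → ℝ}
    (hstep : ∀ k : ℕ, k < K → ∀ s s' : S, |Vhat (k + 1) s s' - sgtOp (Vhat k) s s'| ≤ ε)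
    {traj : ℕ → S}
    (hgreedy : ∀ k : ℕ, 1 ≤ k → k ≤ K → ∀ i : ℕ, 1 ≤ i → i ≤ 2 ^ (K - k) →
      ∀ m : S,
        Vhat (k - 1) (traj ((i - 1) * 2 ^ k)) (traj ((2 * i - 1) * 2 ^ (k - 1))) +
          Vhat (k - 1) (traj ((2 * i - 1) * 2 ^ (k - 1))) (traj (i * 2 ^ k)) ≤
        Vhat (k - 1) (traj ((i - 1) * 2 ^ k)) m + Vhat (k - 1) m (traj (i * 2 ^ k)))
    (k : ℕ) (hk : k ≤ K) (i : ℕ) (hi : i < 2 ^ (K - k)) :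
    ∑ t ∈ Finset.range (2 ^ k), Vhat 0 (traj (i * 2 ^ k + t)) (traj (i * 2 ^ k + t + 1)) ≤
      Vhat k (traj (i * 2 ^ k)) (traj ((i + 1) * 2 ^ k)) + (2 ^ k - 1) * ε := by
  induction k generalizing i with
  | zero => simp
  | succ k ih =>
    have hK : 2 ^ (K - k) = 2 * 2 ^ (K - (k + 1)) := by
      rw [← pow_succ']
      congr 1
      omega
    have hl := ih (by omega) (2 * i) (by omega)
    have hr := ih (by omega) (2 * i + 1) (by omega)
    have hV := (abs_le.mp (hstep k hk (traj (i * 2 ^ (k + 1))) (traj ((i + 1) * 2 ^ (k + 1))))).1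
    have hmid := hgreedy (k + 1) (by omega) hk (i + 1) (by omega) hi
    have hT := (Finset.le_inf'_iff Finset.univ_nonempty _).mpr fun m _ => hmid m
    change _ ≤ sgtOp (Vhat k) _ _ at hT
    have e : 2 * (i + 1) - 1 = 2 * i + 1 := by omega
    simp only [add_tsub_cancel_right, e] at hT
    have hpow : 2 ^ (k + 1) = 2 ^ k + 2 ^ k := by ring
    have e₀ : i * 2 ^ (k + 1) = 2 * i * 2 ^ k := by ring
    have e₁ : (i + 1) * 2 ^ (k + 1) = (2 * i + 1 + 1) * 2 ^ k := by ring
    have e₂ : ∀ t, 2 * i * 2 ^ k + (2 ^ k + t) = (2 * i + 1) * 2 ^ k + t := fun t => by ring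
    rw [e₀, e₁] at hT hV ⊢
    rw [hpow, Finset.sum_range_add]
    simp only [e₂]
    have hε : ((2 : ℝ) ^ (k + 1) - 1) * ε = (2 ^ k - 1) * ε + (2 ^ k - 1) * ε + ε := by ring
    linarith

/-- Let the graph have `N = 2^K` vertices (`K ≥ 1`), let `V̂_0, …, V̂_K` be an
`ε`-approximate SGTDP sequence, and let `s_0, …, s_N` be an approximate greedy SGT trajectory
from `s` to `g` (at each level `k = K, …, 1` and each segment `i`, the midpoint
`s_{(2i−1)·2^{k−1}}` minimizes `V̂_{k−1}(s_{(i−1)·2^k}, ·) + V̂_{k−1}(·, s_{i·2^k})`).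
Then `Σ_{i=0}^{N−1} c(s_i, s_{i+1}) ≤ V*(s, g) + 4·N·log₂(N)·ε` (with `log₂ N = K`). -/
theorem approx_greedy_sgt_trajectory_error {S : Type*} [Fintype S] [Nonempty S]
    (K N : ℕ) (hK : 1 ≤ K) (hNK : N = 2 ^ K) (hcard : Fintype.card S = N)
    (c : S → S → ℝ) (hcnn : ∀ s s' : S, 0 ≤ c s s') (hdiag : ∀ s : S, c s s = 0)
    (ε : ℝ) (hε : 0 ≤ ε) (Vhat : ℕ → S → S → ℝ)
    (h0 : ∀ s s' : S, |Vhat 0 s s' - c s s'| ≤ ε)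
    (hstep : ∀ k : ℕ, k < K → ∀ s s' : S,
      |Vhat (k + 1) s s' - sgtOp (Vhat k) s s'| ≤ ε)
    (s g : S) (traj : ℕ → S) (hstart : traj 0 = s) (hgoal : traj N = g)
    (hgreedy : ∀ k : ℕ, 1 ≤ k → k ≤ K → ∀ i : ℕ, 1 ≤ i → i ≤ 2 ^ (K - k) →
      ∀ m : S,
        Vhat (k - 1) (traj ((i - 1) * 2 ^ k)) (traj ((2 * i - 1) * 2 ^ (k - 1))) +
          Vhat (k - 1) (traj ((2 * i - 1) * 2 ^ (k - 1))) (traj (i * 2 ^ k)) ≤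
        Vhat (k - 1) (traj ((i - 1) * 2 ^ k)) m + Vhat (k - 1) m (traj (i * 2 ^ k))) :
    ∑ t ∈ Finset.range N, c (traj t) (traj (t + 1)) ≤
      VstarR c s g + 4 * (N : ℝ) * (K : ℝ) * ε := by
  subst hNK
  have hvalue : Vhat K s g ≤ VstarR c s g + (2 ^ (K + 1) - 1) * ε := by
    rw [← sub_le_iff_le_add]
    refine le_csInf ⟨_, [s, g], rfl, rfl, rfl⟩ ?_
    rintro x ⟨p, hhead, hlast, rfl⟩
    obtain ⟨q, hq, hqhead, hqlast, hcost⟩ := exists_nodup_pathCostR_le hcnn p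
    rw [hhead] at hqhead
    rw [hlast] at hqlast
    have hlen : q.length ≤ 2 ^ K := hcard ▸ hq.length_le_card
    have hsum := sum_getD_eq_pathCostR hdiag g q (2 ^ K) hqlast (by omega)
    have hwalk := approx_sgt_le_sum h0 hstep K le_rfl fun t => q.getD t g
    have hfirst : q.getD 0 g = s := by
      cases q with
      | nil => simp at hqhead
      | cons a q => simpa using hqhead
    simp only [hfirst, List.getD_eq_default q g hlen, hsum] at hwalk
    linarith
  have htraj := sum_approx_sgt_le hstep hgreedy K le_rfl 0 (by simp)
  simp only [zero_mul, zero_add, one_mul, hstart, hgoal] at htraj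
  have hedges : ∑ t ∈ Finset.range (2 ^ K), c (traj t) (traj (t + 1)) ≤
      ∑ t ∈ Finset.range (2 ^ K), Vhat 0 (traj t) (traj (t + 1)) + 2 ^ K * ε := by
    calc _ ≤ ∑ t ∈ Finset.range (2 ^ K), (Vhat 0 (traj t) (traj (t + 1)) + ε) :=
          Finset.sum_le_sum fun t _ => by
            linarith [(abs_le.mp (h0 (traj t) (traj (t + 1)))).1]
      _ = _ := by simp [Finset.sum_add_distrib]
  have hKε : 4 * 2 ^ K * ε ≤ 4 * ((2 ^ K : ℕ) : ℝ) * (K : ℝ) * ε := by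
    have hK' : (1 : ℝ) ≤ K := by exact_mod_cast hK
    push_cast
    refine mul_le_mul_of_nonneg_right ?_ hε
    exact le_mul_of_one_le_right (by positivity) hK'
  have hε' : ((2 : ℝ) ^ (K + 1) - 1) * ε + (2 ^ K - 1) * ε + 2 ^ K * ε =
      4 * 2 ^ K * ε - 2 * ε := by ring
  linarith
end
end

section
/- (Segment-cost variance reduction.) Let π_θ be a parametrized stochastic SGT policy with trajectory distribution Pr_θ over S^{T+1}, T = 2^D, and J(θ) = Σ_{τ ∈ S^{T+1}} c_τ · Pr_θ[τ]. Then for every θ ∈ ℝ^n, ∇_θ J(θ) = Σ_{d=1}^{D} Σ_{i=1}^{2^{D−d}} Σ_{τ} Pr_θ[τ] · c_{(i−1)·2^d : i·2^d}(τ) · ∇_θ log π_θ( s_m^{i,d} | s^{i,d}, g^{i,d} ), where c_{a:b}(τ) = Σ_{t=a}^{b−1} c(s_t, s_{t+1}); that is, in the policy-gradient expression the total trajectory cost c_τ multiplying the score of the sub-goal decision at node (i,d) can be replaced by the cost of the segment of τ spanned by that node. -/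
noncomputable section

/-- Recursively defined sub-goal tree likelihood of the segment of the trajectory `τ`
starting at index `a` and spanning `2^k` steps. `π θ s g m` denotes `π_θ(m | s, g)`. -/
def segLik {E S : Type*} (π : E → S → S → S → ℝ) (θ : E) (τ : ℕ → S) :
    ℕ → ℕ → ℝ
  | _, 0 => 1
  | a, k + 1 =>
      π θ (τ a) (τ (a + 2 ^ (k + 1))) (τ (a + 2 ^ k)) *
        segLik π θ τ a k * segLik π θ τ (a + 2 ^ k) k

/-- View a trajectory `τ ∈ S^{T+1}` as a function on `ℕ` (indices beyond `T` are clamped). -/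
def liftT {S : Type*} {T : ℕ} (τ : Fin (T + 1) → S) (t : ℕ) : S :=
  τ ⟨min t T, by omega⟩

/-- The probability of a trajectory `τ ∈ S^{T+1}`, `T = 2^D`:
`Pr_θ[τ] = ρ₀(s_0, s_T) · Pr_θ[τ | s_0, s_T]`. -/
def trajProb {E S : Type*} (ρ₀ : S → S → ℝ) (π : E → S → S → S → ℝ) (D : ℕ)
    (θ : E) (τ : Fin (2 ^ D + 1) → S) : ℝ :=
  ρ₀ (liftT τ 0) (liftT τ (2 ^ D)) * segLik π θ (liftT τ) 0 D

/-- `c_{a:b}(τ) = Σ_{t=a}^{b−1} c(s_t, s_{t+1})`: the cost of the sub-trajectory of `τ`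
from index `a` to index `b`. -/
def segCost {S : Type*} (c : S → S → ℝ) {T : ℕ} (τ : Fin (T + 1) → S) (a b : ℕ) : ℝ :=
  ∑ t ∈ Finset.Ico a b, c (liftT τ t) (liftT τ (t + 1))

open Finset Function

section Dependence

variable {E S : Type*}

lemma segLik_pos {π : E → S → S → S → ℝ} (hpos : ∀ θ s g m, 0 < π θ s g m)
    (θ : E) (τ : ℕ → S) (a k : ℕ) : 0 < segLik π θ τ a k := by
  induction k generalizing a with
  | zero => simp [segLik]
  | succ k ih => exact mul_pos (mul_pos (hpos _ _ _ _) (ih _)) (ih _)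

lemma dependsOn_segLik (π : E → S → S → S → ℝ) (θ : E) (a k : ℕ) :
    DependsOn (fun τ : ℕ → S => segLik π θ τ a k) (Set.Icc a (a + 2 ^ k)) := by
  induction k generalizing a with
  | zero => intro x y _; rfl
  | succ k ih =>
    intro x y h
    have e : 2 ^ (k + 1) = 2 ^ k + 2 ^ k := by ring
    have hk : 0 < 2 ^ k := by positivity
    simp only [segLik]
    congr 1
    · congr 1
      · rw [h a ⟨by omega, by omega⟩, h (a + 2 ^ (k + 1)) ⟨by omega, by omega⟩,
          h (a + 2 ^ k) ⟨by omega, by omega⟩]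
      · exact ih a fun t ht => h t ⟨ht.1, by have := ht.2; omega⟩
    · exact ih (a + 2 ^ k) fun t ht =>
        h t ⟨by have := ht.1; omega, by have := ht.2; omega⟩

/-- The likelihood of a block is the likelihood of a descendant block times a factor which does not
involve the states in the interior of that descendant. -/
lemma exists_segLik_eq_mul (π : E → S → S → S → ℝ) (θ : E) (i d e : ℕ) :
    ∃ O : (ℕ → S) → ℝ, DependsOn O (Set.Ioo (i * 2 ^ d) ((i + 1) * 2 ^ d))ᶜ ∧
      ∀ τ, segLik π θ τ (i / 2 ^ e * 2 ^ (d + e)) (d + e) =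
        O τ * segLik π θ τ (i * 2 ^ d) d := by
  induction e with
  | zero => exact ⟨fun _ => 1, fun _ _ _ => rfl, by simp⟩
  | succ e ih =>
    obtain ⟨O, hO, hτ⟩ := ih
    set q := i / 2 ^ e
    have hp : i / 2 ^ (e + 1) = q / 2 := by rw [pow_succ, Nat.div_div_eq_div_mul]
    rw [hp]
    set p := q / 2
    have lo : q * 2 ^ (d + e) ≤ i * 2 ^ d := by
      rw [add_comm d e, pow_add, ← mul_assoc]
      exact Nat.mul_le_mul_right _ (Nat.div_mul_le_self _ _)
    have hi : (i + 1) * 2 ^ d ≤ (q + 1) * 2 ^ (d + e) := by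
      rw [add_comm d e, pow_add, ← mul_assoc]
      refine Nat.mul_le_mul_right _ ?_
      have := Nat.lt_div_mul_add (a := i) (b := 2 ^ e) (by positivity)
      rw [add_mul, one_mul]
      exact this
    set A := 2 ^ (d + e) with hA
    have hA2 : 2 ^ (d + e + 1) = 2 * A := by rw [pow_succ, mul_comm]
    have hnode : ∀ x y : ℕ → S,
        (∀ t ∈ (Set.Ioo (i * 2 ^ d) ((i + 1) * 2 ^ d))ᶜ, x t = y t) → ∀ t, x (t * A) = y (t * A) := by
      intro x y h t
      refine h _ fun ht => ?_
      have h1 : q * A < t * A := lo.trans_lt ht.1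
      have h2 : t * A < (q + 1) * A := ht.2.trans_le hi
      have := Nat.lt_of_mul_lt_mul_right h1
      have := Nat.lt_of_mul_lt_mul_right h2
      omega
    have e0 : p * (2 * A) = (2 * p) * A := by ring
    have e1 : (2 * p) * A + A = (2 * p + 1) * A := by ring
    have e2 : (2 * p) * A + 2 * A = (2 * p + 2) * A := by ring
    have hsib : ∀ r, r ≠ q → DependsOn (fun τ : ℕ → S => segLik π θ τ (r * A) (d + e))
        (Set.Ioo (i * 2 ^ d) ((i + 1) * 2 ^ d))ᶜ := by
      intro r hr
      refine (dependsOn_segLik π θ (r * A) (d + e)).mono fun t ht ht' => ?_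
      have h1 : r * A ≤ t := ht.1
      have h2 : t ≤ (r + 1) * A := by rw [add_mul, one_mul]; exact ht.2
      have h3 : q * A < (r + 1) * A := by have := ht'.1; omega
      have h4 : r * A < (q + 1) * A := by have := ht'.2; omega
      have := Nat.lt_of_mul_lt_mul_right h3
      have := Nat.lt_of_mul_lt_mul_right h4
      omega
    rcases (by omega : q = 2 * p ∨ q = 2 * p + 1) with h | h
    · refine ⟨fun τ => π θ (τ ((2 * p) * A)) (τ ((2 * p + 2) * A)) (τ ((2 * p + 1) * A)) * O τ *
        segLik π θ τ ((2 * p + 1) * A) (d + e), ?_, fun τ => ?_⟩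
      · intro x y hxy
        have hs := hsib (2 * p + 1) (by omega) hxy
        simp only [hnode x y hxy, hO hxy] at hs ⊢
        rw [hs]
      · rw [← add_assoc, segLik, hA2, e0, ← hA, e1, e2]
        have := hτ τ
        rw [h] at this
        rw [this]
        ring
    · refine ⟨fun τ => π θ (τ ((2 * p) * A)) (τ ((2 * p + 2) * A)) (τ ((2 * p + 1) * A)) * O τ *
        segLik π θ τ ((2 * p) * A) (d + e), ?_, fun τ => ?_⟩
      · intro x y hxy
        have hs := hsib (2 * p) (by omega) hxy
        simp only [hnode x y hxy, hO hxy] at hs ⊢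
        rw [hs]
      · rw [← add_assoc, segLik, hA2, e0, ← hA, e1, e2]
        have := hτ τ
        rw [h] at this
        rw [this]
        ring

/-- The recursive likelihood as a product over the nodes of the sub-goal tree. -/
lemma segLik_eq_prod (π : E → S → S → S → ℝ) (θ : E) (τ : ℕ → S) (j k : ℕ) :
    segLik π θ τ (j * 2 ^ k) k =
      ∏ d ∈ Icc 1 k, ∏ i ∈ Ioc (j * 2 ^ (k - d)) ((j + 1) * 2 ^ (k - d)),
        π θ (τ ((i - 1) * 2 ^ d)) (τ (i * 2 ^ d)) (τ ((2 * i - 1) * 2 ^ (d - 1))) := by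
  induction k generalizing j with
  | zero => simp [segLik]
  | succ k ih =>
    have e0 : j * 2 ^ (k + 1) = (2 * j) * 2 ^ k := by ring
    have e1 : (2 * j) * 2 ^ k + 2 ^ k = (2 * j + 1) * 2 ^ k := by ring
    have e2 : j * 2 ^ (k + 1) + 2 ^ (k + 1) = (j + 1) * 2 ^ (k + 1) := by ring
    rw [Finset.prod_Icc_succ_top (by omega), segLik, e2, e0, e1, ih, ih, mul_assoc, mul_comm,
      ← Finset.prod_mul_distrib]
    congr 1
    · refine Finset.prod_congr rfl fun d hd => ?_
      have hd' : k + 1 - d = (k - d) + 1 := by have := Finset.mem_Icc.1 hd; omega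
      have f0 : j * 2 ^ (k - d + 1) = (2 * j) * 2 ^ (k - d) := by ring
      have f1 : (j + 1) * 2 ^ (k - d + 1) = (2 * j + 1 + 1) * 2 ^ (k - d) := by ring
      rw [hd', f0, f1]
      exact Finset.prod_Ioc_consecutive _ (Nat.mul_le_mul_right _ (by omega))
        (Nat.mul_le_mul_right _ (by omega))
    · have hs : Ioc j (j + 1) = {j + 1} := by ext; simp
      have hm : 2 * (j + 1) - 1 = 2 * j + 1 := by omega
      simp [hs, hm, e0]

end Dependence

section Marginalization

lemma liftT_update {S : Type*} {T : ℕ} (τ : Fin (T + 1) → S) {j : ℕ} (hj : j < T) (m : S) :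
    liftT (update τ ⟨j, by omega⟩ m) = update (liftT τ) j m := by
  funext t
  by_cases h : t = j
  · subst h
    have : min t T = t := by omega
    simp [liftT, this]
  · have : min t T ≠ j := by omega
    simp [liftT, h, this]

variable {E S V : Type*} [Fintype S] [AddCommGroup V] [Module ℝ V] {T : ℕ}

/-- Resampling one coordinate in a sum over all trajectories. -/
lemma card_smul_sum_liftT (F : (ℕ → S) → V) {j : ℕ} (hj : j < T) :
    (Fintype.card S : ℝ) • ∑ τ : Fin (T + 1) → S, F (liftT τ) =
      ∑ τ : Fin (T + 1) → S, ∑ m, F (update (liftT τ) j m) := by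
  let J : Fin (T + 1) := ⟨j, by omega⟩
  have hinv : Involutive fun p : (Fin (T + 1) → S) × S => (update p.1 J p.2, p.1 J) := by
    rintro ⟨τ, m⟩
    simp
  have h := Equiv.sum_comp hinv.toPerm fun p => F (liftT p.1)
  simp only [Fintype.sum_prod_type, Involutive.coe_toPerm, J, liftT_update _ hj] at h
  rw [h]
  simp [Finset.smul_sum, Nat.cast_smul_eq_nsmul]

lemma sum_liftT_eq_zero_of_sum_update [Nonempty S] {F : (ℕ → S) → V} {j : ℕ} (hj : j < T)
    (h : ∑ τ : Fin (T + 1) → S, ∑ m, F (update (liftT τ) j m) = 0) :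
    ∑ τ : Fin (T + 1) → S, F (liftT τ) = 0 := by
  rw [← card_smul_sum_liftT F hj] at h
  exact (smul_eq_zero.1 h).resolve_left (by simp)

/-- Weighting by the likelihood of a block preserves the vanishing of sums of functions which do
not involve the interior states of the block. -/
lemma sum_segLik_smul_eq_zero [Nonempty S] {π : E → S → S → S → ℝ}
    (hpmf : ∀ θ s g, ∑ m, π θ s g m = 1) (θ : E) {a k : ℕ} (hT : a + 2 ^ k ≤ T)
    {F : (ℕ → S) → V} (hF : DependsOn F (Set.Ioo a (a + 2 ^ k))ᶜ)
    (h0 : ∑ τ : Fin (T + 1) → S, F (liftT τ) = 0) :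
    ∑ τ : Fin (T + 1) → S, segLik π θ (liftT τ) a k • F (liftT τ) = 0 := by
  induction k generalizing a F with
  | zero => simpa [segLik] using h0
  | succ k ih =>
    have e : 2 ^ (k + 1) = 2 ^ k + 2 ^ k := by ring
    have hk : 0 < 2 ^ k := by positivity
    let P : (ℕ → S) → ℝ := fun τ => π θ (τ a) (τ (a + 2 ^ (k + 1))) (τ (a + 2 ^ k))
    have hP : ∑ τ : Fin (T + 1) → S, P (liftT τ) • F (liftT τ) = 0 := by
      refine sum_liftT_eq_zero_of_sum_update (F := fun τ => P τ • F τ) (j := a + 2 ^ k)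
        (by omega) ?_
      rw [← h0]
      refine Finset.sum_congr rfl fun τ _ => ?_
      have hFm : ∀ m, F (update (liftT τ) (a + 2 ^ k) m) = F (liftT τ) := fun m => by
        refine hF fun t ht => update_of_ne ?_ _ _
        rintro rfl
        exact ht ⟨by omega, by omega⟩
      have h1 : a ≠ a + 2 ^ k := by omega
      have h2 : a + 2 ^ (k + 1) ≠ a + 2 ^ k := by omega
      simp only [hFm, P, update_self, update_of_ne h1, update_of_ne h2]
      rw [← Finset.sum_smul, hpmf, one_smul]
    have hPdep : ∀ x y : ℕ → S, x a = y a → x (a + 2 ^ (k + 1)) = y (a + 2 ^ (k + 1)) →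
        x (a + 2 ^ k) = y (a + 2 ^ k) → P x = P y := fun x y h1 h2 h3 => by
      simp only [P, h1, h2, h3]
    have hR := ih (a := a + 2 ^ k) (F := fun τ => P τ • F τ) (by omega) (by
      intro x y h
      have h' : ∀ t, t ≤ a + 2 ^ k ∨ a + 2 ^ (k + 1) ≤ t → x t = y t := fun t ht =>
        h t fun hh => by have h1 := hh.1; have h2 := hh.2; omega
      simp only
      rw [hPdep x y (h' _ (by omega)) (h' _ (by omega)) (h' _ (by omega)),
        hF fun t ht => h' t ?_]
      by_contra hc
      exact ht ⟨by omega, by omega⟩) hP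
    have hL := ih (a := a) (F := fun τ => segLik π θ τ (a + 2 ^ k) k • P τ • F τ) (by omega) (by
      intro x y h
      have h' : ∀ t, t ≤ a ∨ a + 2 ^ k ≤ t → x t = y t := fun t ht =>
        h t fun hh => by have h1 := hh.1; have h2 := hh.2; omega
      have hs := dependsOn_segLik π θ (a + 2 ^ k) k fun t ht => h' t (Or.inr ht.1)
      simp only at hs ⊢
      rw [hs, hPdep x y (h' _ (by omega)) (h' _ (by omega)) (h' _ (by omega)),
        hF fun t ht => h' t ?_]
      by_contra hc
      exact ht ⟨by omega, by omega⟩) hR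
    rw [← hL]
    refine Finset.sum_congr rfl fun τ _ => ?_
    simp only [segLik, P, smul_smul]
    congr 1
    ring

/-- A score-type term at a node, weighted by the likelihood of the block spanned by that node and
by a factor which does not involve the interior states of the block, has zero total. -/
lemma sum_segLik_smul_score_eq_zero [Nonempty S] {π : E → S → S → S → ℝ}
    (hpmf : ∀ θ s g, ∑ m, π θ s g m = 1) (θ : E) {a k : ℕ} (hT : a + 2 ^ (k + 1) ≤ T)
    {H : (ℕ → S) → ℝ} (hH : DependsOn H (Set.Ioo a (a + 2 ^ (k + 1)))ᶜ)
    {v : S → S → S → V} (hv : ∀ s g, ∑ m, π θ s g m • v s g m = 0) :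
    ∑ τ : Fin (T + 1) → S, (H (liftT τ) * segLik π θ (liftT τ) a (k + 1)) •
      v (liftT τ a) (liftT τ (a + 2 ^ (k + 1))) (liftT τ (a + 2 ^ k)) = 0 := by
  have e : 2 ^ (k + 1) = 2 ^ k + 2 ^ k := by ring
  have hk : 0 < 2 ^ k := by positivity
  let P : (ℕ → S) → V := fun τ =>
    π θ (τ a) (τ (a + 2 ^ (k + 1))) (τ (a + 2 ^ k)) •
      v (τ a) (τ (a + 2 ^ (k + 1))) (τ (a + 2 ^ k))
  have hP : ∑ τ : Fin (T + 1) → S, H (liftT τ) • P (liftT τ) = 0 := by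
    refine sum_liftT_eq_zero_of_sum_update (F := fun τ => H τ • P τ) (j := a + 2 ^ k)
      (by omega) (Finset.sum_eq_zero fun τ _ => ?_)
    have hHm : ∀ m, H (update (liftT τ) (a + 2 ^ k) m) = H (liftT τ) := fun m => by
      refine hH fun t ht => update_of_ne ?_ _ _
      rintro rfl
      exact ht ⟨by omega, by omega⟩
    have h1 : a ≠ a + 2 ^ k := by omega
    have h2 : a + 2 ^ (k + 1) ≠ a + 2 ^ k := by omega
    simp only [hHm, P, update_self, update_of_ne h1, update_of_ne h2]
    rw [← Finset.smul_sum, hv, smul_zero]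
  have hPdep : ∀ x y : ℕ → S, x a = y a → x (a + 2 ^ (k + 1)) = y (a + 2 ^ (k + 1)) →
      x (a + 2 ^ k) = y (a + 2 ^ k) → P x = P y := fun x y h1 h2 h3 => by
    simp only [P, h1, h2, h3]
  have hR := sum_segLik_smul_eq_zero hpmf θ (a := a + 2 ^ k) (k := k) (T := T)
    (F := fun τ => H τ • P τ) (by omega) (by
      intro x y h
      have h' : ∀ t, t ≤ a + 2 ^ k ∨ a + 2 ^ (k + 1) ≤ t → x t = y t := fun t ht =>
        h t fun hh => by have h1 := hh.1; have h2 := hh.2; omega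
      simp only
      rw [hPdep x y (h' _ (by omega)) (h' _ (by omega)) (h' _ (by omega)),
        hH fun t ht => h' t ?_]
      by_contra hc
      exact ht ⟨by omega, by omega⟩) hP
  have hL := sum_segLik_smul_eq_zero hpmf θ (a := a) (k := k) (T := T)
    (F := fun τ => segLik π θ τ (a + 2 ^ k) k • H τ • P τ) (by omega) (by
      intro x y h
      have h' : ∀ t, t ≤ a ∨ a + 2 ^ k ≤ t → x t = y t := fun t ht =>
        h t fun hh => by have h1 := hh.1; have h2 := hh.2; omega
      have hs := dependsOn_segLik π θ (a + 2 ^ k) k fun t ht => h' t (Or.inr ht.1)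
      simp only at hs ⊢
      rw [hs, hPdep x y (h' _ (by omega)) (h' _ (by omega)) (h' _ (by omega)),
        hH fun t ht => h' t ?_]
      by_contra hc
      exact ht ⟨by omega, by omega⟩) hR
  rw [← hL]
  refine Finset.sum_congr rfl fun τ _ => ?_
  simp only [segLik, P, smul_smul]
  congr 1
  ring

end Marginalization

section Gradient

variable {F : Type*} [NormedAddCommGroup F] [InnerProductSpace ℝ F] [CompleteSpace F]

lemma gradient_finset_sum {ι : Type*} {s : Finset ι} {f : ι → F → ℝ} {x : F}
    (h : ∀ i ∈ s, DifferentiableAt ℝ (f i) x) :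
    gradient (fun y => ∑ i ∈ s, f i y) x = ∑ i ∈ s, gradient (f i) x := by
  simp only [gradient, fderiv_fun_sum h, map_sum]

lemma gradient_const_mul {f : F → ℝ} {x : F} (h : DifferentiableAt ℝ f x) (r : ℝ) :
    gradient (fun y => r * f y) x = r • gradient f x := by
  simp only [gradient, fderiv_const_mul h, map_smul]

lemma smul_gradient_log {f : F → ℝ} {x : F} (h : DifferentiableAt ℝ f x) (h0 : f x ≠ 0) :
    f x • gradient (fun y => Real.log (f y)) x = gradient f x := by
  simp only [gradient, fderiv.log h h0]
  simp [smul_smul, h0]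

end Gradient

section Policy

variable {F S : Type*} [NormedAddCommGroup F] [InnerProductSpace ℝ F]
  {π : F → S → S → S → ℝ}

lemma differentiable_segLik (hdiff : ∀ s g m, Differentiable ℝ fun θ => π θ s g m)
    (τ : ℕ → S) (a k : ℕ) : Differentiable ℝ fun θ => segLik π θ τ a k := by
  induction k generalizing a with
  | zero => simp [segLik]
  | succ k ih => exact ((hdiff _ _ _).mul (ih _)).mul (ih _)

variable [CompleteSpace F]

lemma sum_smul_score_eq_zero [Fintype S] (hpos : ∀ θ s g m, 0 < π θ s g m)
    (hpmf : ∀ θ s g, ∑ m, π θ s g m = 1)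
    (hdiff : ∀ s g m, Differentiable ℝ fun θ => π θ s g m) (θ : F) (s g : S) :
    ∑ m, π θ s g m • gradient (fun θ' => Real.log (π θ' s g m)) θ = 0 := by
  rw [Finset.sum_congr rfl fun m _ => smul_gradient_log (hdiff s g m θ) (hpos θ s g m).ne',
    ← gradient_finset_sum fun m _ => hdiff s g m θ]
  simp [hpmf]

lemma gradient_segLik (hpos : ∀ θ s g m, 0 < π θ s g m)
    (hdiff : ∀ s g m, Differentiable ℝ fun θ => π θ s g m) (τ : ℕ → S) (D : ℕ) (θ : F) :
    gradient (fun θ' => segLik π θ' τ 0 D) θ =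
      segLik π θ τ 0 D • ∑ d ∈ Icc 1 D, ∑ i ∈ Icc 1 (2 ^ (D - d)),
        gradient (fun θ' => Real.log (π θ' (τ ((i - 1) * 2 ^ d)) (τ (i * 2 ^ d))
          (τ ((2 * i - 1) * 2 ^ (d - 1))))) θ := by
  have hlog : ∀ s g m, DifferentiableAt ℝ (fun θ' => Real.log (π θ' s g m)) θ := fun s g m =>
    (hdiff s g m θ).log (hpos θ s g m).ne'
  rw [← smul_gradient_log (differentiable_segLik hdiff τ 0 D θ) (segLik_pos hpos θ τ 0 D).ne']
  congr 1
  have hsum : (fun θ' => Real.log (segLik π θ' τ 0 D)) = fun θ' =>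
      ∑ d ∈ Icc 1 D, ∑ i ∈ Icc 1 (2 ^ (D - d)),
        Real.log (π θ' (τ ((i - 1) * 2 ^ d)) (τ (i * 2 ^ d))
          (τ ((2 * i - 1) * 2 ^ (d - 1)))) := by
    funext θ'
    have h := segLik_eq_prod π θ' τ 0 D
    simp only [zero_mul, zero_add, one_mul] at h
    rw [h, Real.log_prod fun d _ => (Finset.prod_pos fun i _ => hpos _ _ _ _).ne']
    refine Finset.sum_congr rfl fun d _ => ?_
    rw [Real.log_prod fun i _ => (hpos _ _ _ _).ne']
    rfl
  rw [hsum, gradient_finset_sum fun d _ => DifferentiableAt.fun_sum fun i _ => hlog _ _ _]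
  exact Finset.sum_congr rfl fun d _ => gradient_finset_sum fun i _ => hlog _ _ _

/-- The cost incurred outside the segment spanned by a node does not contribute to the policy
gradient term of that node. -/
lemma sum_trajProb_mul_segCost_smul_score [Fintype S] [Nonempty S]
    (hpos : ∀ θ s g m, 0 < π θ s g m) (hpmf : ∀ θ s g, ∑ m, π θ s g m = 1)
    (hdiff : ∀ s g m, Differentiable ℝ fun θ => π θ s g m)
    (c ρ₀ : S → S → ℝ) (θ : F) {D k i : ℕ} (hk : k + 1 ≤ D) (hi : i < 2 ^ (D - (k + 1))) :
    ∑ τ : Fin (2 ^ D + 1) → S, (trajProb ρ₀ π D θ τ * segCost c τ 0 (2 ^ D)) •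
        gradient (fun θ' => Real.log (π θ' (liftT τ (i * 2 ^ (k + 1)))
          (liftT τ ((i + 1) * 2 ^ (k + 1))) (liftT τ ((2 * i + 1) * 2 ^ k)))) θ =
      ∑ τ : Fin (2 ^ D + 1) → S, (trajProb ρ₀ π D θ τ *
          segCost c τ (i * 2 ^ (k + 1)) ((i + 1) * 2 ^ (k + 1))) •
        gradient (fun θ' => Real.log (π θ' (liftT τ (i * 2 ^ (k + 1)))
          (liftT τ ((i + 1) * 2 ^ (k + 1))) (liftT τ ((2 * i + 1) * 2 ^ k)))) θ := by
  obtain ⟨e, rfl⟩ := Nat.exists_eq_add_of_le hk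
  rw [Nat.add_sub_cancel_left] at hi
  obtain ⟨O, hO, hτ⟩ := exists_segLik_eq_mul π θ i (k + 1) e
  rw [Nat.div_eq_of_lt hi, zero_mul] at hτ
  have hb : (i + 1) * 2 ^ (k + 1) = i * 2 ^ (k + 1) + 2 ^ (k + 1) := by ring
  have hm : (2 * i + 1) * 2 ^ k = i * 2 ^ (k + 1) + 2 ^ k := by ring
  have hT : i * 2 ^ (k + 1) + 2 ^ (k + 1) ≤ 2 ^ (k + 1 + e) := by
    rw [← hb, add_comm (k + 1) e, pow_add 2 e]
    exact Nat.mul_le_mul_right _ hi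
  rw [hb] at hO
  rw [hb, hm, ← sub_eq_zero, ← Finset.sum_sub_distrib]
  set a := i * 2 ^ (k + 1)
  set b := a + 2 ^ (k + 1)
  have hab : a < b := Nat.lt_add_of_pos_right (by positivity)
  let H : (ℕ → S) → ℝ := fun τ => ρ₀ (τ 0) (τ (2 ^ (k + 1 + e))) * O τ *
    (∑ t ∈ Ico 0 a, c (τ t) (τ (t + 1)) + ∑ t ∈ Ico b (2 ^ (k + 1 + e)), c (τ t) (τ (t + 1)))
  have hH : DependsOn H (Set.Ioo a b)ᶜ := by
    intro x y h
    have h' : ∀ t, t ≤ a ∨ b ≤ t → x t = y t := fun t ht =>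
      h t fun hh => by have h1 := hh.1; have h2 := hh.2; omega
    simp only [H]
    rw [h' 0 (by omega), h' (2 ^ (k + 1 + e)) (by omega), hO h]
    congr 2
    · refine Finset.sum_congr rfl fun t ht => ?_
      have := Finset.mem_Ico.1 ht
      rw [h' t (by omega), h' (t + 1) (by omega)]
    · refine Finset.sum_congr rfl fun t ht => ?_
      have := Finset.mem_Ico.1 ht
      rw [h' t (by omega), h' (t + 1) (by omega)]
  rw [← sum_segLik_smul_score_eq_zero hpmf θ hT hH
    (sum_smul_score_eq_zero hpos hpmf hdiff θ)]
  refine Finset.sum_congr rfl fun τ _ => ?_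
  rw [← sub_smul]
  congr 1
  simp only [trajProb, segCost, hτ, H]
  rw [← Finset.sum_Ico_consecutive _ (Nat.zero_le a) (hab.le.trans hT),
    ← Finset.sum_Ico_consecutive _ hab.le hT]
  ring

end Policy

/-- **Segment-cost variance reduction.** With
`J(θ) = Σ_τ c_τ · Pr_θ[τ]`, for every `θ`:
`∇_θ J(θ) = Σ_{d=1}^{D} Σ_{i=1}^{2^{D−d}} Σ_τ Pr_θ[τ] ·
c_{(i−1)·2^d : i·2^d}(τ) · ∇_θ log π_θ(s_m^{i,d} | s^{i,d}, g^{i,d})`: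
in the policy-gradient expression the total cost multiplying the score of the sub-goal
decision at node `(i,d)` can be replaced by the cost of the segment spanned by that node. -/
theorem sgt_segment_cost_variance_reduction
    {S : Type*} [Fintype S] [Nonempty S] [DecidableEq S] {n D : ℕ}
    (hn : 1 ≤ n) (hD : 1 ≤ D)
    (c : S → S → ℝ)
    (π : EuclideanSpace ℝ (Fin n) → S → S → S → ℝ)
    (hpos : ∀ (θ : EuclideanSpace ℝ (Fin n)) (s g m : S), 0 < π θ s g m)
    (hpmf : ∀ (θ : EuclideanSpace ℝ (Fin n)) (s g : S), ∑ m : S, π θ s g m = 1)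
    (hdiff : ∀ s g m : S, Differentiable ℝ fun θ : EuclideanSpace ℝ (Fin n) => π θ s g m)
    (ρ₀ : S → S → ℝ) (hρpos : ∀ s g : S, 0 < ρ₀ s g)
    (hρpmf : ∑ s : S, ∑ g : S, ρ₀ s g = 1)
    (J : EuclideanSpace ℝ (Fin n) → ℝ)
    (hJ : ∀ θ : EuclideanSpace ℝ (Fin n),
      J θ = ∑ τ : Fin (2 ^ D + 1) → S, segCost c τ 0 (2 ^ D) * trajProb ρ₀ π D θ τ) :
    ∀ θ : EuclideanSpace ℝ (Fin n),
      gradient J θ =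
        ∑ d ∈ Finset.Icc 1 D, ∑ i ∈ Finset.Icc 1 (2 ^ (D - d)),
          ∑ τ : Fin (2 ^ D + 1) → S,
            (trajProb ρ₀ π D θ τ * segCost c τ ((i - 1) * 2 ^ d) (i * 2 ^ d)) •
              gradient (fun θ' : EuclideanSpace ℝ (Fin n) =>
                Real.log (π θ' (liftT τ ((i - 1) * 2 ^ d)) (liftT τ (i * 2 ^ d))
                  (liftT τ ((2 * i - 1) * 2 ^ (d - 1))))) θ := by
  intro θ
  have hJ' : J = fun θ => ∑ τ : Fin (2 ^ D + 1) → S,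
      (segCost c τ 0 (2 ^ D) * ρ₀ (liftT τ 0) (liftT τ (2 ^ D))) *
        segLik π θ (liftT τ) 0 D := by
    funext θ
    simp only [hJ, trajProb, mul_assoc]
  have hL : ∀ τ : Fin (2 ^ D + 1) → S,
      DifferentiableAt ℝ (fun θ => segLik π θ (liftT τ) 0 D) θ := fun τ =>
    differentiable_segLik hdiff _ _ _ θ
  rw [hJ', gradient_finset_sum fun τ _ => (hL τ).const_mul _]
  simp only [gradient_const_mul (hL _), gradient_segLik hpos hdiff, Finset.smul_sum, smul_smul]
  rw [Finset.sum_comm]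
  refine Finset.sum_congr rfl fun d hd => ?_
  rw [Finset.sum_comm]
  refine Finset.sum_congr rfl fun i hi => ?_
  obtain ⟨hd1, hdD⟩ := Finset.mem_Icc.1 hd
  obtain ⟨hi1, hiD⟩ := Finset.mem_Icc.1 hi
  obtain ⟨k, rfl⟩ := Nat.exists_eq_add_of_le' hd1
  obtain ⟨i, rfl⟩ := Nat.exists_eq_add_of_le' hi1
  have hm : 2 * (i + 1) - 1 = 2 * i + 1 := by omega
  simp only [Nat.add_sub_cancel, hm]
  rw [← sum_trajProb_mul_segCost_smul_score hpos hpmf hdiff c ρ₀ θ hdD (by omega)]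
  refine Finset.sum_congr rfl fun τ _ => ?_
  congr 1
  simp only [trajProb]
  ring
end
end
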